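/- arXiv:2308.07192 — 4 statements merged into one kernel-verified Lean document; each statement's English description precedes it below -/
import Mathlib

section
/- Let P ∈ (0,1), α > 0, β > 0, and define the expected per-item loss L : (0,1) → ℝ by L(p) = -(β·P·log p + α·(1-P)·log(1-p)). Then L attains a unique global minimum on (0,1) at the point p* = β·P / (α - α·P + β·P); that is, L(p*) < L(p) for every p ∈ (0,1) with p ≠ p*. -/
/-- Tangent-line bound for the function `y ↦ x * log y` at `y = x`, strict away from `x`. -/
theorem mul_log_lt_mul_log_add_sub {x y : ℝ} (hx : 0 < x) (hy : 0 < y) (hxy : y ≠ x) :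
    x * Real.log y < x * Real.log x + (y - x) := by
  have h := Real.log_lt_sub_one_of_pos (div_pos hy hx) (by rwa [Ne, div_eq_one_iff_eq hx.ne'])
  rw [Real.log_div hy.ne' hx.ne'] at h
  have h' := mul_lt_mul_of_pos_left h hx
  have hyx : x * (y / x - 1) = y - x := by field_simp
  linarith

/-- Gibbs' inequality for two Bernoulli distributions. -/
theorem bernoulli_gibbs_lt {p q : ℝ} (hp : p ∈ Set.Ioo (0 : ℝ) 1) (hq : q ∈ Set.Ioo (0 : ℝ) 1)
    (hpq : p ≠ q) :
    q * Real.log p + (1 - q) * Real.log (1 - p) <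
      q * Real.log q + (1 - q) * Real.log (1 - q) := by
  have h₁ := mul_log_lt_mul_log_add_sub hq.1 hp.1 hpq
  have h₂ := mul_log_lt_mul_log_add_sub (sub_pos.2 hq.2) (sub_pos.2 hp.2)
    (fun h => hpq (sub_right_injective h))
  linarith

/-- The expected per-item gBCE loss `L p = -(β·P·log p + α·(1-P)·log(1-p))` attains a unique
global minimum on `(0,1)` at `p* = β·P / (α - α·P + β·P)`. -/
theorem gbce_unique_global_min (P α β : ℝ) (hP : P ∈ Set.Ioo (0:ℝ) 1)
    (hα : 0 < α) (hβ : 0 < β)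
    (L : ℝ → ℝ) (hL : ∀ p, L p = -(β * P * Real.log p + α * (1 - P) * Real.log (1 - p)))
    (pstar : ℝ) (hpstar : pstar = β * P / (α - α * P + β * P)) :
    pstar ∈ Set.Ioo (0:ℝ) 1 ∧
      ∀ p ∈ Set.Ioo (0:ℝ) 1, p ≠ pstar → L pstar < L p := by
  obtain ⟨hP0, hP1⟩ := hP
  have ha : 0 < β * P := mul_pos hβ hP0
  have hb : 0 < α * (1 - P) := mul_pos hα (sub_pos.2 hP1)
  have hs : 0 < α - α * P + β * P := by linarith
  have hq : pstar ∈ Set.Ioo (0 : ℝ) 1 := by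
    rw [hpstar]
    exact ⟨div_pos ha hs, (div_lt_one hs).2 (by linarith)⟩
  refine ⟨hq, fun p hp hne => ?_⟩
  have hpos : β * P = (α - α * P + β * P) * pstar := by
    rw [hpstar, mul_div_cancel₀ _ hs.ne']
  have hneg : α * (1 - P) = (α - α * P + β * P) * (1 - pstar) := by linarith
  have hL' (x : ℝ) : L x = -((α - α * P + β * P) *
      (pstar * Real.log x + (1 - pstar) * Real.log (1 - x))) := by
    rw [hL]
    linear_combination -Real.log x * hpos - Real.log (1 - x) * hneg
  rw [hL', hL']
  exact neg_lt_neg (mul_lt_mul_of_pos_left (bernoulli_gibbs_lt hp hq hne) hs)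
end

section
/- Let P ∈ (0,1) and α > 0. Then the unique minimiser on (0,1) of L(p) = -(P·log p + α·(1-P)·log(1-p)) equals P / (α - α·P + P); that is, a model trained with standard Binary Cross-Entropy loss (gBCE with β = 1) and negative sampling rate α converges to predict probability P / (α - α·P + P) for an item with prior probability P. -/
/-- Strict tangent-line bound for the logarithm, scaled by a positive base point. -/
theorem mul_log_sub_log_lt_sub {p q : ℝ} (hp : 0 < p) (hq : 0 < q) (hpq : p ≠ q) :
    q * (Real.log p - Real.log q) < p - q := by
  rw [← Real.log_div hp.ne' hq.ne']
  have h := Real.log_lt_sub_one_of_pos (div_pos hp hq) (by rwa [ne_eq, div_eq_one_iff_eq hq.ne'])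
  calc q * Real.log (p / q) < q * (p / q - 1) := mul_lt_mul_of_pos_left h hq
    _ = p - q := by field_simp

/-- With standard BCE loss (gBCE with `β = 1`) and negative sampling rate `α`, the unique
minimiser on `(0,1)` of `L p = -(P·log p + α·(1-P)·log(1-p))` is `P / (α - α·P + P)`. -/
theorem bce_converged_prob (P α : ℝ) (hP : P ∈ Set.Ioo (0:ℝ) 1) (hα : 0 < α)
    (L : ℝ → ℝ) (hL : ∀ p, L p = -(P * Real.log p + α * (1 - P) * Real.log (1 - p)))
    (pstar : ℝ) (hpstar : pstar = P / (α - α * P + P)) :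
    pstar ∈ Set.Ioo (0:ℝ) 1 ∧
      ∀ p ∈ Set.Ioo (0:ℝ) 1, p ≠ pstar → L pstar < L p := by
  have hb : 0 < α * (1 - P) := mul_pos hα (sub_pos.2 hP.2)
  have hs : 0 < α - α * P + P := by linarith [hP.1]
  have hq : pstar ∈ Set.Ioo (0 : ℝ) 1 := by
    rw [hpstar]
    exact ⟨div_pos hP.1 hs, (div_lt_one hs).2 (by linarith)⟩
  have hPq : P = (α - α * P + P) * pstar := by
    rw [hpstar, mul_div_cancel₀ _ hs.ne']
  have hbq : α * (1 - P) = (α - α * P + P) * (1 - pstar) := by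
    linarith
  have hfactor (x : ℝ) : L x = -((α - α * P + P) *
      (pstar * Real.log x + (1 - pstar) * Real.log (1 - x))) := by
    rw [hL, hbq]
    linear_combination -Real.log x * hPq
  refine ⟨hq, fun p hp hne => ?_⟩
  rw [hfactor, hfactor]
  exact neg_lt_neg (mul_lt_mul_of_pos_left (bernoulli_gibbs_lt hp hq hne) hs)
end

section
/- Let α > 0 and β > 0. Then the function P ↦ β·P / (α - α·P + β·P) is strictly monotonically increasing on the interval [0,1], with value 0 at P = 0 and value 1 at P = 1. In particular, ranking items by the converged gBCE-predicted probabilities produces the same order as ranking them by their prior probabilities. -/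
/-- The denominator of the converged gBCE probability is positive on `[0,1]`. -/
theorem gbce_denom_pos {α β P : ℝ} (hα : 0 < α) (hβ : 0 < β) (hP : P ∈ Set.Icc (0 : ℝ) 1) :
    0 < α - α * P + β * P := by
  rcases hP.1.eq_or_lt with rfl | h
  · simpa using hα
  · nlinarith [mul_pos hβ h, mul_nonneg hα.le (sub_nonneg.2 hP.2)]

/-- For fixed `α > 0` and `β > 0`, the converged gBCE probability
`P ↦ β·P / (α - α·P + β·P)` is strictly monotonically increasing on `[0,1]`, with value `0`
at `P = 0` and value `1` at `P = 1`. -/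
theorem gbce_prob_strictMonoOn (α β : ℝ) (hα : 0 < α) (hβ : 0 < β) :
    StrictMonoOn (fun P : ℝ => β * P / (α - α * P + β * P)) (Set.Icc 0 1) ∧
      (fun P : ℝ => β * P / (α - α * P + β * P)) 0 = 0 ∧
      (fun P : ℝ => β * P / (α - α * P + β * P)) 1 = 1 := by
  refine ⟨fun x hx y hy hxy => ?_, by simp, by simp [hβ.ne']⟩
  rw [div_lt_div_iff₀ (gbce_denom_pos hα hβ hx) (gbce_denom_pos hα hβ hy)]
  linarith [mul_pos (mul_pos hα hβ) (sub_pos.2 hxy)]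
end

section
/- Let σ(s) = 1/(1 + e^{-s}) be the logistic sigmoid, β > 0, γ(s) = log(1/(σ(s)^{-β} - 1)), k a natural number, s⁺ a real number, and s⁻ : Fin k → ℝ a family of negative-item scores. Define gBCE(s⁺, s⁻) = -(1/(k+1))·(log(σ(s⁺)^β) + Σ_{i} log(1 - σ(s⁻_i))) and BCE(x, s⁻) = -(1/(k+1))·(log(σ(x)) + Σ_{i} log(1 - σ(s⁻_i))). Then gBCE(s⁺, s⁻) = BCE(γ(s⁺), s⁻). That is, the generalised Binary Cross-Entropy loss on scores (s⁺, s⁻) equals the ordinary Binary Cross-Entropy loss applied to the transformed positive score γ(s⁺) and the same negative scores. -/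
/-- The logit of `p ^ β` is `log (1 / (p ^ (-β) - 1))`. -/
theorem Real.sigmoid_log_one_div_rpow_neg_sub_one {p β : ℝ} (hp₀ : 0 < p) (hp₁ : p < 1)
    (hβ : 0 < β) : Real.sigmoid (Real.log (1 / (p ^ (-β) - 1))) = p ^ β := by
  have h : 0 < p ^ (-β) - 1 :=
    sub_pos.mpr (Real.one_lt_rpow_of_pos_of_lt_one_of_neg hp₀ hp₁ (neg_lt_zero.mpr hβ))
  rw [Real.sigmoid_def, one_div, Real.log_inv, neg_neg, Real.exp_log h, add_sub_cancel,
    Real.rpow_neg hp₀.le, inv_inv]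

/-- The generalised Binary Cross-Entropy loss on scores `(s⁺, s⁻)` equals the ordinary Binary
Cross-Entropy loss applied to the transformed positive score `γ(s⁺)` and the same negative
scores. -/
theorem gbce_eq_bce_transformed (σ : ℝ → ℝ) (hσ : ∀ s, σ s = 1 / (1 + Real.exp (-s)))
    (β : ℝ) (hβ : 0 < β)
    (γ : ℝ → ℝ) (hγ : ∀ s, γ s = Real.log (1 / (σ s ^ (-β) - 1)))
    (k : ℕ) (spos : ℝ) (sneg : Fin k → ℝ)
    (gBCE : ℝ → (Fin k → ℝ) → ℝ)
    (hgBCE : ∀ x t, gBCE x t =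
      -(1 / ((k : ℝ) + 1)) * (Real.log (σ x ^ β) + ∑ i, Real.log (1 - σ (t i))))
    (BCE : ℝ → (Fin k → ℝ) → ℝ)
    (hBCE : ∀ x t, BCE x t =
      -(1 / ((k : ℝ) + 1)) * (Real.log (σ x) + ∑ i, Real.log (1 - σ (t i)))) :
    gBCE spos sneg = BCE (γ spos) sneg := by
  obtain rfl : σ = Real.sigmoid := funext fun s => by rw [hσ, one_div, Real.sigmoid_def]
  rw [hgBCE, hBCE, hγ, Real.sigmoid_log_one_div_rpow_neg_sub_one (Real.sigmoid_pos spos)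
    (Real.sigmoid_lt_one spos) hβ]
end
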